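/- arXiv:2003.12990 — 4 statements merged into one kernel-verified Lean document; each statement's English description precedes it below -/
import Mathlib

section
/- Identity for the squared dependence estimator of a bipartite function: Let F : Ω_X × Ω_Y → ℝ where Ω_X and Ω_Y are finite probability spaces, let (x, y) be sampled from the product measure with x′, y′ independent copies of x, y, and let F̄ = F − E[F]. Then E[(F(x, y) + F(x′, y′) − F(x, y′) − F(x′, y))²] = 4·E[(F̄(x, y) − g(x) − h(y))²], where g(x) = E[F̄(x, y) | x] and h(y) = E[F̄(x, y) | y]. -/
open Finset

/-- For a centred `u`, the mean squared difference of two independent samples of `u` is twice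
the mean square of `u`. -/
lemma sum_sum_mul_sq_sub_of_centered {ι : Type*} [Fintype ι] (μ u : ι → ℝ)
    (hμ : ∑ a, μ a = 1) (hu : ∑ a, μ a * u a = 0) :
    ∑ a, ∑ b, μ a * μ b * (u a - u b) ^ 2 = 2 * ∑ a, μ a * u a ^ 2 := by
  have inner_sum (a : ι) : ∑ b, μ a * μ b * (u a - u b) ^ 2
      = μ a * u a ^ 2 + μ a * ∑ b, μ b * u b ^ 2 := by
    calc ∑ b, μ a * μ b * (u a - u b) ^ 2
        = μ a * u a ^ 2 * ∑ b, μ b - 2 * μ a * u a * ∑ b, μ b * u b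
            + μ a * ∑ b, μ b * u b ^ 2 := by
          simp only [mul_sum, ← sum_sub_distrib, ← sum_add_distrib]
          exact sum_congr rfl fun b _ => by ring
      _ = _ := by rw [hμ, hu]; ring
  simp only [inner_sum, sum_add_distrib, ← sum_mul, hμ]
  ring

/-- The mean squared mixed difference of a function that is centred in each variable is four
times its mean square. -/
lemma sum_mul_sq_mixed_difference_of_centered {α β : Type*} [Fintype α] [Fintype β]
    (μ : α → ℝ) (ν : β → ℝ) (hμ : ∑ a, μ a = 1) (hν : ∑ b, ν b = 1) (R : α → β → ℝ)
    (hR₁ : ∀ b, ∑ a, μ a * R a b = 0) (hR₂ : ∀ a, ∑ b, ν b * R a b = 0) :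
    ∑ x, ∑ y, ∑ x', ∑ y', μ x * ν y * μ x' * ν y' * (R x y + R x' y' - R x y' - R x' y) ^ 2
      = 4 * ∑ x, ∑ y, μ x * ν y * R x y ^ 2 := by
  have sum_over_second (x x' : α) :
      ∑ y, ∑ y', ν y * ν y' * ((R x y - R x' y) - (R x y' - R x' y')) ^ 2
        = 2 * ∑ y, ν y * (R x y - R x' y) ^ 2 :=
    sum_sum_mul_sq_sub_of_centered ν (fun y => R x y - R x' y) hν
      (by simp only [mul_sub, sum_sub_distrib, hR₂, sub_zero])
  have sum_over_first (y : β) :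
      ∑ x, ∑ x', μ x * μ x' * (R x y - R x' y) ^ 2 = 2 * ∑ x, μ x * R x y ^ 2 :=
    sum_sum_mul_sq_sub_of_centered μ (fun x => R x y) hμ (hR₁ y)
  calc ∑ x, ∑ y, ∑ x', ∑ y', μ x * ν y * μ x' * ν y' * (R x y + R x' y' - R x y' - R x' y) ^ 2
      = ∑ x, ∑ x', μ x * μ x' *
          ∑ y, ∑ y', ν y * ν y' * ((R x y - R x' y) - (R x y' - R x' y')) ^ 2 := by
        refine sum_congr rfl fun x _ => ?_
        rw [sum_comm]
        simp only [mul_sum]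
        exact sum_congr rfl fun x' _ => sum_congr rfl fun y _ => sum_congr rfl fun y' _ => by ring
    _ = ∑ x, ∑ x', ∑ y, 2 * ν y * (μ x * μ x' * (R x y - R x' y) ^ 2) := by
        simp only [sum_over_second, mul_sum]
        exact sum_congr rfl fun x _ => sum_congr rfl fun x' _ => sum_congr rfl fun y _ => by ring
    _ = ∑ y, 2 * ν y * ∑ x, ∑ x', μ x * μ x' * (R x y - R x' y) ^ 2 := by
        simp only [mul_sum]
        symm
        rw [sum_comm]
        exact sum_congr rfl fun x _ => sum_comm
    _ = 4 * ∑ x, ∑ y, μ x * ν y * R x y ^ 2 := by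
        simp only [sum_over_first, mul_sum]
        rw [sum_comm]
        exact sum_congr rfl fun x _ => sum_congr rfl fun y _ => by ring

/-- Identity for the squared dependence estimator of a bipartite function:
`E[(F(x,y) + F(x',y') − F(x,y') − F(x',y))²] = 4·E[(F̄(x,y) − g(x) − h(y))²]`,
where `x, x'` are i.i.d. with law `μX`, `y, y'` are i.i.d. with law `μY` (all four
independent), `F̄ = F − E[F]`, `g(x) = E[F̄(x,y) | x]` and `h(y) = E[F̄(x,y) | y]`. -/
theorem squared_dependence_estimator_identity
    {ΩX ΩY : Type*} [Fintype ΩX] [Fintype ΩY]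
    (μX : ΩX → ℝ) (μY : ΩY → ℝ)
    (hX0 : ∀ a, 0 ≤ μX a) (hX1 : ∑ a, μX a = 1)
    (hY0 : ∀ b, 0 ≤ μY b) (hY1 : ∑ b, μY b = 1)
    (F : ΩX → ΩY → ℝ) :
    (∑ x, ∑ y, ∑ x', ∑ y', μX x * μY y * μX x' * μY y' *
        (F x y + F x' y' - F x y' - F x' y) ^ 2)
    = 4 * ∑ x, ∑ y, μX x * μY y *
        ((F x y - ∑ a, ∑ b, μX a * μY b * F a b)
          - (∑ b, μY b * (F x b - ∑ a', ∑ b', μX a' * μY b' * F a' b'))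
          - (∑ a, μX a * (F a y - ∑ a', ∑ b', μX a' * μY b' * F a' b'))) ^ 2 := by
  set c := ∑ a, ∑ b, μX a * μY b * F a b with hc
  have sum_first (y : ΩY) : ∑ a, μX a * (F a y - c) = ∑ a, μX a * F a y - c := by
    simp only [mul_sub, sum_sub_distrib, ← sum_mul, hX1, one_mul]
  have sum_second (x : ΩX) : ∑ b, μY b * (F x b - c) = ∑ b, μY b * F x b - c := by
    simp only [mul_sub, sum_sub_distrib, ← sum_mul, hY1, one_mul]
  have mean_first : ∑ x, μX x * ∑ b, μY b * F x b = c := by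
    simp only [hc, mul_sum, mul_assoc]
  have mean_second : ∑ y, μY y * ∑ a, μX a * F a y = c := by
    simp only [hc, mul_sum]
    rw [sum_comm]
    exact sum_congr rfl fun x _ => sum_congr rfl fun y _ => by ring
  simp only [sum_first, sum_second]
  rw [← sum_mul_sq_mixed_difference_of_centered μX μY hX1 hY1
    (fun x y => F x y - c - (∑ b, μY b * F x b - c) - (∑ a, μX a * F a y - c))]
  · exact sum_congr rfl fun x _ => sum_congr rfl fun y _ => sum_congr rfl fun x' _ =>
      sum_congr rfl fun y' _ => by ring
  · intro y
    simp only [mul_sub, sum_sub_distrib, mean_first, ← sum_mul, hX1]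
    ring
  · intro x
    simp only [mul_sub, sum_sub_distrib, mean_second, ← sum_mul, hY1]
    ring
end

section
/- Optimality of conditional expectations for 2-norm decomposition: Let Ω_1, …, Ω_k be finite probability spaces, let X_1, …, X_k be independent random elements of Ω_1, …, Ω_k, and let F : Ω_1 × ⋯ × Ω_k → ℝ satisfy E[F] = 0. Then for all functions F_1 : Ω_1 → ℝ, …, F_k : Ω_k → ℝ, E[(F(X_1,…,X_k) − F_1(X_1) − ⋯ − F_k(X_k))²] ≥ E[(F(X_1,…,X_k) − g_1(X_1) − ⋯ − g_k(X_k))²], where g_i(x_i) = E[F(X_1,…,X_k) | X_i = x_i]. In other words, the decomposition F_i = E[F | X_i] achieves the minimum 2-norm decomposition error for the partition (X_1, …, X_k). -/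
open Finset

/-- Product-measure weight of the point `x` of `Ω 0 × ⋯ × Ω (k-1)`. -/
noncomputable def wgt {k : ℕ} {Ω : Fin k → Type*} [∀ i, Fintype (Ω i)]
    (μ : ∀ i, Ω i → ℝ) (x : ∀ i, Ω i) : ℝ :=
  ∏ i, μ i (x i)

/-- The conditional expectation `E[F | X_i = a]` of `F` under the product measure `μ`
(valid whenever each `μ i` is a probability distribution). -/
noncomputable def condExp {k : ℕ} {Ω : Fin k → Type*} [∀ i, Fintype (Ω i)]
    (μ : ∀ i, Ω i → ℝ) (F : (∀ i, Ω i) → ℝ) (i : Fin k) (a : Ω i) : ℝ :=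
  ∑ x : ∀ j, Ω j, wgt μ x * F (Function.update x i a)

section

variable {k : ℕ} {Ω : Fin k → Type*} [∀ i, Fintype (Ω i)] {μ : ∀ i, Ω i → ℝ}

theorem wgt_nonneg (hμ0 : ∀ i a, 0 ≤ μ i a) (x : ∀ i, Ω i) : 0 ≤ wgt μ x :=
  Finset.prod_nonneg fun i _ => hμ0 i (x i)

theorem sum_wgt (hμ1 : ∀ i, ∑ a, μ i a = 1) : ∑ x : ∀ i, Ω i, wgt μ x = 1 := by
  simp only [wgt, ← Fintype.prod_sum, hμ1, Finset.prod_const_one]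

/-- Exchanging the `i`-th coordinate with an independent copy preserves the joint weight. -/
theorem wgt_update_mul (x : ∀ i, Ω i) (i : Fin k) (a : Ω i) :
    wgt μ (Function.update x i a) * μ i (x i) = wgt μ x * μ i a := by
  have h : ∏ j ∈ Finset.univ.erase i, μ j (Function.update x i a j) =
      ∏ j ∈ Finset.univ.erase i, μ j (x j) :=
    Finset.prod_congr rfl fun j hj => by
      rw [Function.update_of_ne (Finset.ne_of_mem_erase hj)]
  unfold wgt
  rw [← Finset.mul_prod_erase _ _ (Finset.mem_univ i),
    ← Finset.mul_prod_erase _ (fun j => μ j (x j)) (Finset.mem_univ i), h,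
    Function.update_self]
  ring

/-- The law of total expectation. -/
theorem sum_mul_condExp (hμ1 : ∀ i, ∑ a, μ i a = 1) (G : (∀ i, Ω i) → ℝ) (i : Fin k) :
    ∑ a, μ i a * condExp μ G i a = ∑ x : ∀ i, Ω i, wgt μ x * G x := by
  calc ∑ a, μ i a * condExp μ G i a
      = ∑ p : (∀ j, Ω j) × Ω i, wgt μ p.1 * μ i p.2 * G (Function.update p.1 i p.2) := by
        rw [Fintype.sum_prod_type_right]
        refine Finset.sum_congr rfl fun a _ => ?_
        rw [condExp, Finset.mul_sum]
        exact Finset.sum_congr rfl fun x _ => by ring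
    _ = ∑ p : (∀ j, Ω j) × Ω i, wgt μ p.1 * μ i p.2 * G p.1 := by
        have hinv : Function.Involutive
            fun p : (∀ j, Ω j) × Ω i => (Function.update p.1 i p.2, p.1 i) := by
          rintro ⟨x, a⟩
          simp
        refine Fintype.sum_bijective _ hinv.bijective _ _ fun p => ?_
        rw [wgt_update_mul]
    _ = ∑ x : ∀ i, Ω i, wgt μ x * G x := by
        rw [Fintype.sum_prod_type]
        refine Finset.sum_congr rfl fun x _ => ?_
        dsimp only
        rw [← Finset.sum_mul, ← Finset.mul_sum, hμ1, mul_one]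

theorem condExp_mul_apply (G : (∀ i, Ω i) → ℝ) (i : Fin k) (h : Ω i → ℝ) (a : Ω i) :
    condExp μ (fun x => G x * h (x i)) i a = condExp μ G i a * h a := by
  simp only [condExp, Function.update_self, Finset.sum_mul, mul_assoc]

theorem condExp_apply_self (hμ1 : ∀ i, ∑ a, μ i a = 1) (i : Fin k) (h : Ω i → ℝ) (a : Ω i) :
    condExp μ (fun x => h (x i)) i a = h a := by
  simp only [condExp, Function.update_self, ← Finset.sum_mul, sum_wgt hμ1, one_mul]

theorem condExp_apply_of_ne {i j : Fin k} (hij : j ≠ i) (h : Ω j → ℝ) (a : Ω i) :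
    condExp μ (fun x => h (x j)) i a = ∑ x : ∀ i, Ω i, wgt μ x * h (x j) := by
  simp only [condExp, Function.update_of_ne hij]

theorem sum_wgt_mul_apply (hμ1 : ∀ i, ∑ a, μ i a = 1) (i : Fin k) (h : Ω i → ℝ) :
    ∑ x : ∀ i, Ω i, wgt μ x * h (x i) = ∑ a, μ i a * h a := by
  rw [← sum_mul_condExp hμ1 (fun x => h (x i)) i]
  simp only [condExp_apply_self hμ1]

theorem condExp_sub_sum_condExp (hμ1 : ∀ i, ∑ a, μ i a = 1) (F : (∀ i, Ω i) → ℝ)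
    (hF : ∑ x : ∀ i, Ω i, wgt μ x * F x = 0) (i : Fin k) (a : Ω i) :
    condExp μ (fun x => F x - ∑ j, condExp μ F j (x j)) i a = 0 := by
  have hlin : condExp μ (fun x => F x - ∑ j, condExp μ F j (x j)) i a =
      condExp μ F i a - ∑ j, condExp μ (fun x => condExp μ F j (x j)) i a := by
    rw [condExp, condExp]
    simp only [mul_sub, Finset.sum_sub_distrib, Finset.mul_sum]
    rw [Finset.sum_comm]
    rfl
  rw [hlin, Finset.sum_eq_single i, condExp_apply_self hμ1, sub_self]
  · intro j _ hj
    rw [condExp_apply_of_ne hj, sum_wgt_mul_apply hμ1, sum_mul_condExp hμ1, hF]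
  · exact fun hi => absurd (Finset.mem_univ i) hi

/-- The residual is orthogonal to every function of a single coordinate. -/
theorem sum_wgt_mul_residual_mul_apply (hμ1 : ∀ i, ∑ a, μ i a = 1) (F : (∀ i, Ω i) → ℝ)
    (hF : ∑ x : ∀ i, Ω i, wgt μ x * F x = 0) (i : Fin k) (h : Ω i → ℝ) :
    ∑ x : ∀ i, Ω i, wgt μ x * ((F x - ∑ j, condExp μ F j (x j)) * h (x i)) = 0 := by
  rw [← sum_mul_condExp hμ1 (fun x => (F x - ∑ j, condExp μ F j (x j)) * h (x i)) i]
  refine Finset.sum_eq_zero fun a _ => ?_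
  rw [condExp_mul_apply (fun x => F x - ∑ j, condExp μ F j (x j)),
    condExp_sub_sum_condExp hμ1 F hF, zero_mul, mul_zero]

end

/-- Optimality of conditional expectations for 2-norm decomposition: if `E[F] = 0` then
for all `F_1, …, F_k`,
`E[(F − F_1(X_1) − ⋯ − F_k(X_k))²] ≥ E[(F − g_1(X_1) − ⋯ − g_k(X_k))²]`
where `g_i(a) = E[F | X_i = a]` and `X_1, …, X_k` are independent with laws `μ 1, …, μ k`. -/
theorem condexp_optimal_for_two_norm_decomposition
    {k : ℕ} {Ω : Fin k → Type*} [∀ i, Fintype (Ω i)]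
    (μ : ∀ i, Ω i → ℝ) (hμ0 : ∀ i a, 0 ≤ μ i a) (hμ1 : ∀ i, ∑ a, μ i a = 1)
    (F : (∀ i, Ω i) → ℝ)
    (hF : ∑ x : ∀ i, Ω i, wgt μ x * F x = 0)
    (Fi : ∀ i, Ω i → ℝ) :
    (∑ x : ∀ i, Ω i, wgt μ x * (F x - ∑ i, condExp μ F i (x i)) ^ 2)
      ≤ ∑ x : ∀ i, Ω i, wgt μ x * (F x - ∑ i, Fi i (x i)) ^ 2 := by
  have horth : ∑ x : ∀ i, Ω i, wgt μ x * ((F x - ∑ j, condExp μ F j (x j)) *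
      ∑ i, (condExp μ F i (x i) - Fi i (x i))) = 0 := by
    simp only [Finset.mul_sum]
    rw [Finset.sum_comm]
    exact Finset.sum_eq_zero fun i _ =>
      sum_wgt_mul_residual_mul_apply hμ1 F hF i fun a => condExp μ F i a - Fi i a
  calc ∑ x : ∀ i, Ω i, wgt μ x * (F x - ∑ i, condExp μ F i (x i)) ^ 2
      = ∑ x : ∀ i, Ω i, (wgt μ x * (F x - ∑ i, condExp μ F i (x i)) ^ 2 +
          2 * (wgt μ x * ((F x - ∑ j, condExp μ F j (x j)) *
            ∑ i, (condExp μ F i (x i) - Fi i (x i))))) := by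
        rw [Finset.sum_add_distrib, ← Finset.mul_sum, horth, mul_zero, add_zero]
    _ ≤ ∑ x : ∀ i, Ω i, wgt μ x * (F x - ∑ i, Fi i (x i)) ^ 2 := by
        refine Finset.sum_le_sum fun x _ => ?_
        rw [Finset.sum_sub_distrib]
        have := mul_nonneg (wgt_nonneg hμ0 x)
          (sq_nonneg (∑ i, condExp μ F i (x i) - ∑ i, Fi i (x i)))
        linarith
end

section
/- Exact estimation of bipartition quality under the 2-norm: Let F : Ω_X × Ω_Y → ℝ where Ω_X and Ω_Y are finite probability spaces, let (x, y) be sampled from the product measure with x′, y′ independent copies of x, y. Then E[(F(x, y) + F(x′, y′) − F(x, y′) − F(x′, y))²] = 4 · min_{A : Ω_X → ℝ, B : Ω_Y → ℝ} E[(F(x, y) − A(x) − B(y))²]. Equivalently, ‖D_F(X, Y)‖_{ℝ,2} = 2·δ_{ℝ,2}(X, Y). -/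
open Finset

/-- For a centred function `f`, `E[(f(i) - f(j))²] = 2 E[f²]` when `i, j` are i.i.d. -/
lemma sum_sum_mul_sub_sq_of_sum_eq_zero {ι : Type*} [Fintype ι] (μ f : ι → ℝ)
    (hμ : ∑ i, μ i = 1) (hf : ∑ i, μ i * f i = 0) :
    ∑ i, ∑ j, μ i * μ j * (f i - f j) ^ 2 = 2 * ∑ i, μ i * f i ^ 2 := by
  have h (i j : ι) : μ i * μ j * (f i - f j) ^ 2 =
      μ i * f i ^ 2 * μ j - 2 * (μ i * f i) * (μ j * f j) + μ i * (μ j * f j ^ 2) := by ring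
  simp only [h, sum_add_distrib, sum_sub_distrib, ← mul_sum, ← sum_mul, hμ, hf]
  ring

/-- For `G` with vanishing marginal means, the second moment of its mixed difference is
`4 E[G²]`. -/
lemma sum_mul_mixed_diff_sq_of_marginals_eq_zero {α β : Type*} [Fintype α] [Fintype β]
    (μ : α → ℝ) (ν : β → ℝ) (hμ : ∑ a, μ a = 1) (hν : ∑ b, ν b = 1) (G : α → β → ℝ)
    (hGα : ∀ b, ∑ a, μ a * G a b = 0) (hGβ : ∀ a, ∑ b, ν b * G a b = 0) :
    ∑ x, ∑ y, ∑ x', ∑ y', μ x * ν y * μ x' * ν y' *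
        (G x y + G x' y' - G x y' - G x' y) ^ 2
      = 4 * ∑ x, ∑ y, μ x * ν y * G x y ^ 2 := by
  have inner_eq (x x' : α) : ∑ y, ∑ y', μ x * ν y * μ x' * ν y' *
        (G x y + G x' y' - G x y' - G x' y) ^ 2
      = ∑ y, 2 * ν y * (μ x * μ x' * (G x y - G x' y) ^ 2) := by
    have h := sum_sum_mul_sub_sq_of_sum_eq_zero ν (fun y => G x y - G x' y) hν
      (by simp only [mul_sub, sum_sub_distrib, hGβ, sub_zero])
    have h' := congrArg (fun t => μ x * μ x' * t) h
    simp only [mul_sum] at h'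
    convert h' using 1
    · exact sum_congr rfl fun y _ => sum_congr rfl fun y' _ => by ring
    · exact sum_congr rfl fun y _ => by ring
  calc _ = ∑ x, ∑ x', ∑ y, 2 * ν y * (μ x * μ x' * (G x y - G x' y) ^ 2) :=
        sum_congr rfl fun x _ => by
          rw [sum_comm]
          exact sum_congr rfl fun x' _ => inner_eq x x'
    _ = ∑ y, 2 * ν y * ∑ x, ∑ x', μ x * μ x' * (G x y - G x' y) ^ 2 := by
        simp only [mul_sum]
        rw [sum_comm (s := univ (α := β))]
        exact sum_congr rfl fun x _ => sum_comm
    _ = ∑ y, 2 * ν y * (2 * ∑ x, μ x * G x y ^ 2) :=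
        sum_congr rfl fun y _ => by
          rw [sum_sum_mul_sub_sq_of_sum_eq_zero μ (fun x => G x y) hμ (hGα y)]
    _ = _ := by
        rw [sum_comm]
        simp only [mul_sum]
        exact sum_congr rfl fun y _ => sum_congr rfl fun x _ => by ring

/-- A function with vanishing marginal means is orthogonal to all `A(x) + B(y)`. -/
lemma sum_mul_add_sq_of_marginals_eq_zero {α β : Type*} [Fintype α] [Fintype β]
    (μ : α → ℝ) (ν : β → ℝ) (G : α → β → ℝ)
    (hGα : ∀ b, ∑ a, μ a * G a b = 0) (hGβ : ∀ a, ∑ b, ν b * G a b = 0)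
    (A : α → ℝ) (B : β → ℝ) :
    ∑ x, ∑ y, μ x * ν y * (G x y + (A x + B y)) ^ 2
      = ∑ x, ∑ y, μ x * ν y * G x y ^ 2 + ∑ x, ∑ y, μ x * ν y * (A x + B y) ^ 2 := by
  have hA : ∑ x, ∑ y, (2 * μ x * A x) * (ν y * G x y) = 0 := by
    simp only [← mul_sum, hGβ, mul_zero, sum_const_zero]
  have hB : ∑ x, ∑ y, (2 * ν y * B y) * (μ x * G x y) = 0 := by
    rw [sum_comm]
    simp only [← mul_sum, hGα, mul_zero, sum_const_zero]
  have h (x : α) (y : β) : μ x * ν y * (G x y + (A x + B y)) ^ 2 =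
      μ x * ν y * G x y ^ 2 + μ x * ν y * (A x + B y) ^ 2 +
        (2 * μ x * A x) * (ν y * G x y) + (2 * ν y * B y) * (μ x * G x y) := by ring
  simp only [h, sum_add_distrib]
  rw [hA, hB, add_zero, add_zero]

/-- Exact estimation of bipartition quality under the 2-norm:
`E[(F(x,y) + F(x',y') − F(x,y') − F(x',y))²] = 4 · min_{A,B} E[(F(x,y) − A(x) − B(y))²]`,
where `x, x'` are i.i.d. with law `μX`, `y, y'` are i.i.d. with law `μY` (all four
independent) and the minimum is over all real-valued functions `A` on `ΩX` and `B` on `ΩY`.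
Equivalently, `‖D_F(X, Y)‖_{ℝ,2} = 2·δ_{ℝ,2}(X, Y)`. -/
theorem squared_dependence_estimator_eq_four_min
    {ΩX ΩY : Type*} [Fintype ΩX] [Fintype ΩY]
    (μX : ΩX → ℝ) (μY : ΩY → ℝ)
    (hX0 : ∀ a, 0 ≤ μX a) (hX1 : ∑ a, μX a = 1)
    (hY0 : ∀ b, 0 ≤ μY b) (hY1 : ∑ b, μY b = 1)
    (F : ΩX → ΩY → ℝ) :
    (∑ x, ∑ y, ∑ x', ∑ y', μX x * μY y * μX x' * μY y' *
        (F x y + F x' y' - F x y' - F x' y) ^ 2)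
    = 4 * sInf { d : ℝ | ∃ (A : ΩX → ℝ) (B : ΩY → ℝ),
        d = ∑ x, ∑ y, μX x * μY y * (F x y - A x - B y) ^ 2 } := by
  obtain ⟨a, b, G, hG, hGX, hGY⟩ : ∃ (a : ΩX → ℝ) (b : ΩY → ℝ) (G : ΩX → ΩY → ℝ),
      (∀ x y, F x y = G x y + a x + b y) ∧
      (∀ y, ∑ x, μX x * G x y = 0) ∧ (∀ x, ∑ y, μY y * G x y = 0) := by
    refine ⟨fun x => ∑ y, μY y * F x y,
      fun y => ∑ x, μX x * F x y - ∑ x, μX x * ∑ y, μY y * F x y,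
      fun x y => F x y - ∑ y, μY y * F x y -
        (∑ x, μX x * F x y - ∑ x, μX x * ∑ y, μY y * F x y),
      fun x y => by ring, fun y => ?_, fun x => ?_⟩
    · simp only [mul_sub, sum_sub_distrib, ← sum_mul, hX1]
      ring
    · have hswap : ∑ y, μY y * ∑ x, μX x * F x y = ∑ x, μX x * ∑ y, μY y * F x y := by
        simp only [mul_sum]
        rw [sum_comm]
        exact sum_congr rfl fun x _ => sum_congr rfl fun y _ => by ring
      simp only [mul_sub, sum_sub_distrib, ← sum_mul, hY1, hswap]
      ring
  have hmin : IsLeast { d : ℝ | ∃ (A : ΩX → ℝ) (B : ΩY → ℝ),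
      d = ∑ x, ∑ y, μX x * μY y * (F x y - A x - B y) ^ 2 }
      (∑ x, ∑ y, μX x * μY y * G x y ^ 2) := by
    refine ⟨⟨a, b, sum_congr rfl fun x _ => sum_congr rfl fun y _ => ?_⟩, ?_⟩
    · rw [hG]
      ring
    · rintro d ⟨A, B, rfl⟩
      have hpyth := sum_mul_add_sq_of_marginals_eq_zero μX μY G hGX hGY
        (fun x => a x - A x) (fun y => b y - B y)
      have hnonneg : 0 ≤ ∑ x, ∑ y, μX x * μY y * ((a x - A x) + (b y - B y)) ^ 2 :=
        sum_nonneg fun x _ => sum_nonneg fun y _ =>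
          mul_nonneg (mul_nonneg (hX0 x) (hY0 y)) (sq_nonneg _)
      have hF (x : ΩX) (y : ΩY) :
          F x y - A x - B y = G x y + ((a x - A x) + (b y - B y)) := by
        rw [hG]
        ring
      simp only [hF]
      linarith
  rw [hmin.csInf_eq, ← sum_mul_mixed_diff_sq_of_marginals_eq_zero μX μY hX1 hY1 G hGX hGY]
  refine sum_congr rfl fun x _ => sum_congr rfl fun y _ => sum_congr rfl fun x' _ =>
    sum_congr rfl fun y' _ => ?_
  simp only [hG]
  ring
end

section
/- Bipartition cost of a quadratic form in independent standardized variables: Let x_1, …, x_n be independent real random variables, each taking finitely many values, with E[x_i] = 0 and E[x_i²] = 1 for all i. Let c_{jk} (1 ≤ j < k ≤ n) be real coefficients and F(x) = Σ_{1 ≤ j < k ≤ n} c_{jk}·x_j·x_k. Then for every bipartition (S, T) of {1, …, n}, the minimum over functions A depending only on the coordinates in S and B depending only on the coordinates in T of E[(F − A − B)²] equals the sum of c_{jk}² over all pairs j < k with one index in S and the other in T. -/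
open Finset

/-- `A` depends only on the coordinates in `S` (dependent product version). -/
def DependsOnPi {ι : Type*} {Ω : ι → Type*} {β : Type*}
    (A : (∀ i, Ω i) → β) (S : Finset ι) : Prop :=
  ∀ v w : ∀ i, Ω i, (∀ i ∈ S, v i = w i) → A v = A w

section DependsOn

variable {ι : Type*} {Ω : ι → Type*}

theorem DependsOnPi.update [DecidableEq ι] {A : (∀ i, Ω i) → ℝ} {S : Finset ι} (hA : DependsOnPi A S)
    {k : ι} (hk : k ∉ S) (ω : ∀ i, Ω i) (a : Ω k) : A (Function.update ω k a) = A ω :=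
  hA _ _ fun _ hi => Function.update_of_ne (ne_of_mem_of_not_mem hi hk) _ _

theorem DependsOnPi.add {A B : (∀ i, Ω i) → ℝ} {U : Finset ι} (hA : DependsOnPi A U)
    (hB : DependsOnPi B U) : DependsOnPi (fun ω => A ω + B ω) U :=
  fun v w h => congrArg₂ (· + ·) (hA v w h) (hB v w h)

theorem DependsOnPi.neg {A : (∀ i, Ω i) → ℝ} {U : Finset ι} (hA : DependsOnPi A U) :
    DependsOnPi (fun ω => -A ω) U :=
  fun v w h => congrArg (- ·) (hA v w h)

theorem dependsOnPi_quadratic [Fintype ι] {x : ∀ i, Ω i → ℝ} {d : ι → ι → ℝ} {U : Finset ι}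
    (hd : ∀ j k, d j k ≠ 0 → j ∈ U ∧ k ∈ U) :
    DependsOnPi (fun ω : ∀ i, Ω i => ∑ j, ∑ k, d j k * (x j (ω j) * x k (ω k))) U := by
  intro v w h
  refine Finset.sum_congr rfl fun j _ => Finset.sum_congr rfl fun k _ => ?_
  by_cases hjk : d j k = 0
  · simp [hjk]
  · rw [h j (hd j k hjk).1, h k (hd j k hjk).2]

end DependsOn

section ProductExpectation

variable {ι : Type*} [Fintype ι] [DecidableEq ι] {Ω : ι → Type*} [∀ i, Fintype (Ω i)]

/-- Expectation of `f` under the product of the finite weights `μ i`. -/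
def prodExpect (μ : ∀ i, Ω i → ℝ) (f : (∀ i, Ω i) → ℝ) : ℝ :=
  ∑ ω : ∀ i, Ω i, (∏ i, μ i (ω i)) * f ω

theorem prodExpect_add (μ : ∀ i, Ω i → ℝ) (f g : (∀ i, Ω i) → ℝ) :
    prodExpect μ (fun ω => f ω + g ω) = prodExpect μ f + prodExpect μ g := by
  simp only [prodExpect, mul_add, Finset.sum_add_distrib]

theorem prodExpect_const_mul (μ : ∀ i, Ω i → ℝ) (r : ℝ) (f : (∀ i, Ω i) → ℝ) :
    prodExpect μ (fun ω => r * f ω) = r * prodExpect μ f := by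
  simp only [prodExpect, Finset.mul_sum, mul_left_comm]

theorem prodExpect_sum {κ : Type*} (μ : ∀ i, Ω i → ℝ) (s : Finset κ)
    (f : κ → (∀ i, Ω i) → ℝ) :
    prodExpect μ (fun ω => ∑ j ∈ s, f j ω) = ∑ j ∈ s, prodExpect μ (f j) := by
  simp only [prodExpect, Finset.mul_sum]
  exact Finset.sum_comm

theorem prodExpect_nonneg {μ : ∀ i, Ω i → ℝ} (hμ0 : ∀ i a, 0 ≤ μ i a)
    {f : (∀ i, Ω i) → ℝ} (hf : ∀ ω, 0 ≤ f ω) : 0 ≤ prodExpect μ f :=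
  Finset.sum_nonneg fun ω _ => mul_nonneg (Finset.prod_nonneg fun i _ => hμ0 i (ω i)) (hf ω)

theorem prodExpect_one {μ : ∀ i, Ω i → ℝ} (hμ1 : ∀ i, ∑ a, μ i a = 1) :
    prodExpect μ (fun _ => 1) = 1 := by
  simp only [prodExpect, mul_one]
  rw [← Fintype.prod_sum]
  simp [hμ1]

/-- A function of one coordinate is independent of a function of the other coordinates. -/
theorem prodExpect_mul_of_update {μ : ∀ i, Ω i → ℝ} (hμ1 : ∀ i, ∑ a, μ i a = 1) (k : ι)
    (g : Ω k → ℝ) {h : (∀ i, Ω i) → ℝ}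
    (hh : ∀ ω a, h (Function.update ω k a) = h ω) :
    prodExpect μ (fun ω => g (ω k) * h ω) = (∑ a, μ k a * g a) * prodExpect μ h := by
  have hinv : Function.Involutive
      (fun p : (∀ i, Ω i) × Ω k => (Function.update p.1 k p.2, p.1 k)) := by
    rintro ⟨ω, a⟩
    simp
  have hw : ∀ (ω : ∀ i, Ω i) (a : Ω k),
      (∏ i, μ i (Function.update ω k a i)) * μ k (ω k) = (∏ i, μ i (ω i)) * μ k a := by
    intro ω a
    rw [← Finset.mul_prod_erase _ _ (Finset.mem_univ k),
      ← Finset.mul_prod_erase _ (fun i => μ i (ω i)) (Finset.mem_univ k)]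
    have : ∏ i ∈ Finset.univ.erase k, μ i (Function.update ω k a i)
        = ∏ i ∈ Finset.univ.erase k, μ i (ω i) :=
      Finset.prod_congr rfl fun i hi => by
        rw [Function.update_of_ne (Finset.ne_of_mem_erase hi)]
    rw [this, Function.update_self]
    ring
  calc prodExpect μ (fun ω => g (ω k) * h ω)
      = ∑ p : (∀ i, Ω i) × Ω k, (∏ i, μ i (p.1 i)) * μ k p.2 * (g (p.1 k) * h p.1) := by
        rw [Fintype.sum_prod_type]
        refine Finset.sum_congr rfl fun ω _ => ?_
        simp only
        rw [← Finset.sum_mul, ← Finset.mul_sum, hμ1, mul_one]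
    _ = ∑ p : (∀ i, Ω i) × Ω k, (∏ i, μ i (p.1 i)) * μ k p.2 * (g p.2 * h p.1) := by
        rw [← Equiv.sum_comp hinv.toPerm]
        refine Finset.sum_congr rfl fun p _ => ?_
        simp only [Function.Involutive.coe_toPerm]
        rw [hw, hh, Function.update_self]
    _ = (∑ a, μ k a * g a) * prodExpect μ h := by
        rw [Fintype.sum_prod_type, prodExpect, Finset.mul_sum]
        refine Finset.sum_congr rfl fun ω _ => ?_
        rw [Finset.sum_mul]
        exact Finset.sum_congr rfl fun a _ => by ring

variable {μ : ∀ i, Ω i → ℝ} {x : ∀ i, Ω i → ℝ}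

theorem prodExpect_mul_mul_eq_zero (hμ1 : ∀ i, ∑ a, μ i a = 1)
    (hmean : ∀ i, ∑ a, μ i a * x i a = 0) {j k : ι} (hjk : j ≠ k) {h : (∀ i, Ω i) → ℝ}
    (hh : (∀ ω a, h (Function.update ω j a) = h ω) ∨
      ∀ ω a, h (Function.update ω k a) = h ω) :
    prodExpect μ (fun ω => x j (ω j) * x k (ω k) * h ω) = 0 := by
  rcases hh with hh | hh
  · have := prodExpect_mul_of_update hμ1 j (x j) (h := fun ω => x k (ω k) * h ω)
      fun ω a => by rw [hh, Function.update_of_ne hjk.symm]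
    simpa only [hmean, zero_mul, ← mul_assoc] using this
  · have := prodExpect_mul_of_update hμ1 k (x k) (h := fun ω => x j (ω j) * h ω)
      fun ω a => by rw [hh, Function.update_of_ne hjk]
    simpa only [hmean, zero_mul, mul_left_comm (x k _), mul_assoc] using this

theorem prodExpect_sq_mul_sq (hμ1 : ∀ i, ∑ a, μ i a = 1)
    (hvar : ∀ i, ∑ a, μ i a * (x i a) ^ 2 = 1) {j k : ι} (hjk : j ≠ k) :
    prodExpect μ (fun ω => x j (ω j) ^ 2 * x k (ω k) ^ 2) = 1 := by
  have hk := prodExpect_mul_of_update hμ1 k (fun a => x k a ^ 2) (h := fun _ => 1)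
    fun _ _ => rfl
  rw [prodExpect_mul_of_update hμ1 j (fun a => x j a ^ 2) (h := fun ω => x k (ω k) ^ 2)
    fun ω a => by rw [Function.update_of_ne hjk.symm], hvar, one_mul]
  simpa only [hvar, prodExpect_one hμ1, mul_one] using hk

end ProductExpectation

section QuadraticForm

variable {ι : Type*} [Fintype ι] [LinearOrder ι] {Ω : ι → Type*} [∀ i, Fintype (Ω i)]
  {μ : ∀ i, Ω i → ℝ} {x : ∀ i, Ω i → ℝ}

/-- Products of pairs of independent standardized variables are orthonormal. -/
theorem prodExpect_pair_mul_pair (hμ1 : ∀ i, ∑ a, μ i a = 1)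
    (hmean : ∀ i, ∑ a, μ i a * x i a = 0) (hvar : ∀ i, ∑ a, μ i a * (x i a) ^ 2 = 1)
    {j k l m : ι} (hjk : j < k) (hlm : l < m) :
    prodExpect μ (fun ω => x j (ω j) * x k (ω k) * (x l (ω l) * x m (ω m)))
      = if l = j ∧ m = k then 1 else 0 := by
  split_ifs with h
  · obtain ⟨rfl, rfl⟩ := h
    rw [← prodExpect_sq_mul_sq hμ1 hvar hjk.ne]
    congr 1
    funext ω
    ring
  · apply prodExpect_mul_mul_eq_zero hμ1 hmean hjk.ne
    have hcases : (l ≠ j ∧ m ≠ j) ∨ (l ≠ k ∧ m ≠ k) := by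
      by_contra! hc
      by_cases hl : l = j
      · exact h ⟨hl, hc.2 fun hlk => hjk.ne (hl.symm.trans hlk)⟩
      · have hm := hc.1 hl
        by_cases hlk : l = k
        · exact (hlk ▸ hm ▸ hlm).not_gt hjk
        · exact hjk.ne (hm.symm.trans (hc.2 hlk))
    refine hcases.imp ?_ ?_ <;>
    · rintro ⟨h₁, h₂⟩ ω a
      rw [Function.update_of_ne h₁, Function.update_of_ne h₂]

theorem prodExpect_quadratic_mul (d : ι → ι → ℝ) (h : (∀ i, Ω i) → ℝ) :
    prodExpect μ (fun ω => (∑ j, ∑ k, d j k * (x j (ω j) * x k (ω k))) * h ω)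
      = ∑ j, ∑ k, d j k * prodExpect μ (fun ω => x j (ω j) * x k (ω k) * h ω) := by
  simp only [Finset.sum_mul, prodExpect_sum, mul_assoc, prodExpect_const_mul]

theorem prodExpect_quadratic_sq (hμ1 : ∀ i, ∑ a, μ i a = 1)
    (hmean : ∀ i, ∑ a, μ i a * x i a = 0) (hvar : ∀ i, ∑ a, μ i a * (x i a) ^ 2 = 1)
    {d : ι → ι → ℝ} (hd : ∀ j k, d j k ≠ 0 → j < k) :
    prodExpect μ (fun ω => (∑ j, ∑ k, d j k * (x j (ω j) * x k (ω k))) ^ 2)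
      = ∑ j, ∑ k, d j k ^ 2 := by
  simp only [sq (Finset.sum _ _)]
  rw [prodExpect_quadratic_mul]
  refine Finset.sum_congr rfl fun j _ => Finset.sum_congr rfl fun k _ => ?_
  by_cases hjk : d j k = 0
  · simp [hjk]
  simp only [mul_comm (x j _ * x k _)]
  rw [prodExpect_quadratic_mul, sq]
  congr 1
  have hterm : ∀ l m, d l m * prodExpect μ
      (fun ω => x l (ω l) * x m (ω m) * (x j (ω j) * x k (ω k)))
      = if l = j then if m = k then d l m else 0 else 0 := by
    intro l m
    by_cases hlm : d l m = 0
    · simp [hlm]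
    · rw [prodExpect_pair_mul_pair hμ1 hmean hvar (hd l m hlm) (hd j k hjk)]
      simp only [eq_comm (a := j), eq_comm (a := k), ← ite_and, mul_ite, mul_one, mul_zero]
  simp only [hterm]
  simp

theorem prodExpect_quadratic_mul_eq_zero (hμ1 : ∀ i, ∑ a, μ i a = 1)
    (hmean : ∀ i, ∑ a, μ i a * x i a = 0) {d : ι → ι → ℝ} {U : Finset ι}
    (hd : ∀ j k, d j k ≠ 0 → j < k ∧ (j ∉ U ∨ k ∉ U))
    {A : (∀ i, Ω i) → ℝ} (hA : DependsOnPi A U) :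
    prodExpect μ (fun ω => (∑ j, ∑ k, d j k * (x j (ω j) * x k (ω k))) * A ω) = 0 := by
  rw [prodExpect_quadratic_mul]
  refine Finset.sum_eq_zero fun j _ => Finset.sum_eq_zero fun k _ => ?_
  by_cases hjk : d j k = 0
  · simp [hjk]
  obtain ⟨hlt, hU⟩ := hd j k hjk
  rw [prodExpect_mul_mul_eq_zero hμ1 hmean hlt.ne (hU.imp hA.update hA.update), mul_zero]

end QuadraticForm

/-- Bipartition cost of a quadratic form in independent standardized variables:
if `x_1, …, x_n` are independent with `E[x_i] = 0` and `E[x_i²] = 1`, and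
`F = Σ_{j < k} c_{jk} x_j x_k`, then for every bipartition `(S, T)` of `{1, …, n}` the
minimum over `A` depending only on the coordinates in `S` and `B` depending only on the
coordinates in `T` of `E[(F − A − B)²]` equals `Σ c_{jk}²` over the pairs `j < k` split
by the bipartition. -/
theorem bipartition_cost_of_quadratic_form
    {n : ℕ} {Ω : Fin n → Type*} [∀ i, Fintype (Ω i)]
    (μ : ∀ i, Ω i → ℝ) (hμ0 : ∀ i a, 0 ≤ μ i a) (hμ1 : ∀ i, ∑ a, μ i a = 1)
    (x : ∀ i, Ω i → ℝ)
    (hmean : ∀ i, ∑ a, μ i a * x i a = 0)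
    (hvar : ∀ i, ∑ a, μ i a * (x i a) ^ 2 = 1)
    (c : Fin n → Fin n → ℝ)
    (S T : Finset (Fin n)) (hST : Disjoint S T) (hcover : S ∪ T = Finset.univ) :
    sInf { d : ℝ | ∃ A B : (∀ i, Ω i) → ℝ,
        DependsOnPi A S ∧ DependsOnPi B T ∧
        d = ∑ ω : ∀ i, Ω i, (∏ i, μ i (ω i)) *
              ((∑ j, ∑ k, if j < k then c j k * x j (ω j) * x k (ω k) else 0)
                - A ω - B ω) ^ 2 }
    = ∑ j, ∑ k, if j < k ∧ ¬ (j ∈ S ↔ k ∈ S) then c j k ^ 2 else 0 := by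
  have hT : ∀ i, i ∈ T ↔ i ∉ S := fun i =>
    ⟨fun hiT hiS => Finset.disjoint_left.mp hST hiS hiT, fun hiS =>
      (Finset.mem_union.mp (hcover ▸ Finset.mem_univ i)).resolve_left hiS⟩
  let cross : Fin n → Fin n → ℝ := fun j k => if j < k ∧ ¬ (j ∈ S ↔ k ∈ S) then c j k else 0
  let inS : Fin n → Fin n → ℝ := fun j k => if j < k ∧ j ∈ S ∧ k ∈ S then c j k else 0
  let inT : Fin n → Fin n → ℝ := fun j k => if j < k ∧ j ∈ T ∧ k ∈ T then c j k else 0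
  let Q : (Fin n → Fin n → ℝ) → (∀ i, Ω i) → ℝ :=
    fun d ω => ∑ j, ∑ k, d j k * (x j (ω j) * x k (ω k))
  have hcross : ∀ j k, cross j k ≠ 0 → j < k ∧ ¬ (j ∈ S ↔ k ∈ S) := fun j k h => by
    by_contra hc
    exact h (if_neg hc)
  have hQS : DependsOnPi (Q inS) S := dependsOnPi_quadratic fun j k h => by
    by_contra hc
    exact h (if_neg fun h' => hc h'.2)
  have hQT : DependsOnPi (Q inT) T := dependsOnPi_quadratic fun j k h => by
    by_contra hc
    exact h (if_neg fun h' => hc h'.2)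
  have hF : ∀ ω : ∀ i, Ω i,
      (∑ j, ∑ k, if j < k then c j k * x j (ω j) * x k (ω k) else 0)
        = Q cross ω + Q inS ω + Q inT ω := by
    intro ω
    simp only [Q, ← Finset.sum_add_distrib]
    refine Finset.sum_congr rfl fun j _ => Finset.sum_congr rfl fun k _ => ?_
    simp only [cross, inS, inT, hT]
    by_cases h₁ : j < k <;> by_cases h₂ : j ∈ S <;> by_cases h₃ : k ∈ S <;>
      simp [h₁, h₂, h₃, mul_assoc]
  have hmin : prodExpect μ (fun ω => Q cross ω ^ 2)
      = ∑ j, ∑ k, if j < k ∧ ¬ (j ∈ S ↔ k ∈ S) then c j k ^ 2 else 0 := by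
    rw [prodExpect_quadratic_sq hμ1 hmean hvar fun j k h => (hcross j k h).1]
    simp only [cross, ite_pow, ne_eq, OfNat.ofNat_ne_zero, not_false_eq_true, zero_pow]
  rw [← hmin]
  refine IsLeast.csInf_eq ⟨⟨Q inS, Q inT, hQS, hQT, ?_⟩, ?_⟩
  · refine Finset.sum_congr rfl fun ω _ => ?_
    rw [hF]
    ring
  · rintro _ ⟨A, B, hA, hB, rfl⟩
    have hexpand : (∑ ω : ∀ i, Ω i, (∏ i, μ i (ω i)) *
        ((∑ j, ∑ k, if j < k then c j k * x j (ω j) * x k (ω k) else 0) - A ω - B ω) ^ 2)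
        = prodExpect μ (fun ω => Q cross ω ^ 2
          + (2 * (Q cross ω * (Q inS ω + -A ω)) + (2 * (Q cross ω * (Q inT ω + -B ω))
          + ((Q inS ω + -A ω) + (Q inT ω + -B ω)) ^ 2))) := by
      refine Finset.sum_congr rfl fun ω _ => ?_
      rw [hF]
      ring
    rw [hexpand, prodExpect_add, prodExpect_add, prodExpect_add, prodExpect_const_mul,
      prodExpect_const_mul,
      prodExpect_quadratic_mul_eq_zero hμ1 hmean
        (fun j k h => ⟨(hcross j k h).1, by have := (hcross j k h).2; tauto⟩) (hQS.add hA.neg),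
      prodExpect_quadratic_mul_eq_zero hμ1 hmean
        (fun j k h => ⟨(hcross j k h).1, by
          have := (hcross j k h).2
          rw [hT, hT]
          tauto⟩) (hQT.add hB.neg)]
    have := prodExpect_nonneg hμ0
      (f := fun ω => ((Q inS ω + -A ω) + (Q inT ω + -B ω)) ^ 2) fun ω => sq_nonneg _
    linarith
end
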